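/- Let I be the augmentation ideal of the integral group algebra R = ℤ[ℚ/ℤ] and let l be a prime. For every positive integer k, the k-th power of the ideal (l) + I equals the ideal (l^k) + I, where (l) and (l^k) denote the principal ideals of R generated by l·1 and l^k·1 respectively. -/

import Mathlib

noncomputable section

/-- The group `ℚ/ℤ`. -/
abbrev QZ : Type := AddCircle (1 : ℚ)

/-- The integral group algebra `ℤ[ℚ/ℤ]`. -/
abbrev RZ : Type := AddMonoidAlgebra ℤ QZ

/-- The augmentation ring homomorphism `ℤ[ℚ/ℤ] → ℤ`, sending every group element to `1`. -/
def eps : RZ →+* ℤ :=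
  AddMonoidAlgebra.liftNCRingHom (RingHom.id ℤ) 1 (fun _ _ => Commute.one_right _)

/-- The augmentation ideal `I = ker ε`. -/
def Iaug : Ideal RZ := RingHom.ker eps

theorem eps_single (g : QZ) (a : ℤ) : eps (AddMonoidAlgebra.single g a) = a := by
  simp [eps, AddMonoidAlgebra.liftNCRingHom]

theorem single_pow_sub_one_mem (h : QZ) (n : ℕ) :
    (AddMonoidAlgebra.single h 1 : RZ) ^ n - 1 ∈ Iaug * (Ideal.span {(n : RZ)} + Iaug) := by
  rw [← mul_geom_sum]
  refine Ideal.mul_mem_mul ?_ ?_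
  · simp [Iaug, RingHom.mem_ker, eps_single]
  · rw [← add_sub_cancel (n : RZ) (∑ i ∈ Finset.range n, _)]
    refine Submodule.add_mem_sup (Ideal.mem_span_singleton_self _) ?_
    simp [Iaug, RingHom.mem_ker, eps_single]

theorem sub_eps_mem (n : ℕ) (hn : n ≠ 0) (x : RZ) :
    x - (eps x : RZ) ∈ Iaug * (Ideal.span {(n : RZ)} + Iaug) := by
  induction x using AddMonoidAlgebra.induction_linear with
  | zero => simp
  | add f g hf hg =>
    rw [map_add, Int.cast_add, add_sub_add_comm]
    exact add_mem hf hg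
  | single g a =>
    obtain ⟨q, rfl⟩ := QuotientAddGroup.mk_surjective g
    have hq : ((q : ℚ) : QZ) = n • ((q / n : ℚ) : QZ) := by
      rw [← AddCircle.coe_nsmul, nsmul_eq_mul, mul_div_cancel₀ _ (Nat.cast_ne_zero.mpr hn)]
    have hs : (AddMonoidAlgebra.single ((q : ℚ) : QZ) a : RZ) =
        (a : RZ) * AddMonoidAlgebra.single ((q / n : ℚ) : QZ) 1 ^ n := by
      rw [AddMonoidAlgebra.single_pow, ← hq, ← zsmul_eq_mul, AddMonoidAlgebra.smul_single]
      simp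
    rw [eps_single]
    erw [hs]
    rw [← mul_sub_one]
    exact Ideal.mul_mem_left _ _ (single_pow_sub_one_mem _ n)

theorem Iaug_mul_span_add (n : ℕ) (hn : n ≠ 0) :
    Iaug * (Ideal.span {(n : RZ)} + Iaug) = Iaug := by
  refine le_antisymm Ideal.mul_le_left fun x hx => ?_
  have h := sub_eps_mem n hn x
  rwa [show eps x = 0 from hx, Int.cast_zero, sub_zero] at h

/-- For a prime `l` and every positive integer `k`,
`((l) + I)^k = (l^k) + I` in `ℤ[ℚ/ℤ]`. -/
theorem augmentation_ideal_J_pow (l : ℕ) (hl : l.Prime) :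
    ∀ k : ℕ, 0 < k →
      (Ideal.span {(l : RZ)} + Iaug) ^ k = Ideal.span {((l : RZ) ^ k)} + Iaug := by
  intro k hk
  induction k, hk using Nat.le_induction with
  | base => simp
  | succ k _ ih =>
    rw [pow_succ, ih, add_mul, Iaug_mul_span_add l hl.ne_zero, mul_add,
      Ideal.span_singleton_mul_span_singleton, ← pow_succ, add_assoc]
    congr 1
    exact sup_eq_right.mpr Ideal.mul_le_right
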